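/- arXiv:2403.15722 — 7 statements merged into one kernel-verified Lean document; each statement's English description precedes it below -/
import Mathlib

section
/- Let 𝔤 be a finite-dimensional real Lie algebra, regarded also as a normed real vector space, let B be a symmetric bilinear form on 𝔤, and let F : 𝔤 → 𝔤 satisfy B(F(y), z) = B(y, [y, z]) for all y, z ∈ 𝔤. Let v ∈ 𝔤 be such that ad_v is skew-symmetric with respect to B, i.e. B([v, x], y) = −B(x, [v, y]) for all x, y ∈ 𝔤. If I ⊆ ℝ is an interval and γ : I → 𝔤 is differentiable with γ'(s) = F(γ(s)) for every s ∈ I, then the function s ↦ B(γ(s), v) is constant on I. In particular, the Euler–Arnold vector field F is everywhere tangent to the affine hyperplanes parallel to v^⊥ = {y ∈ 𝔤 : B(y, v) = 0}. -/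
/-- **Clairaut constant along Euler–Arnold solutions.**
Let `L` be a finite-dimensional real Lie algebra regarded also as a normed real
vector space, `B` a symmetric bilinear form, `F` an Euler–Arnold field for
`(L, B)`, and `v ∈ L` with `ad_v` skew-symmetric with respect to `B`.
Then along any Euler–Arnold solution `γ` on an interval `I`, the function
`s ↦ B (γ s) v` is constant; in particular `F` is everywhere tangent to the
affine hyperplanes parallel to `v^⊥`, i.e. `B (F y) v = 0` for all `y`. -/
theorem euler_arnold_clairaut_constant
    {L : Type*} [NormedAddCommGroup L] [NormedSpace ℝ L] [FiniteDimensional ℝ L]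
    (bracket : L →ₗ[ℝ] L →ₗ[ℝ] L)
    (hanti : ∀ x : L, bracket x x = 0)
    (hjacobi : ∀ x y z : L,
      bracket x (bracket y z) = bracket (bracket x y) z + bracket y (bracket x z))
    (B : LinearMap.BilinForm ℝ L)
    (hBsymm : ∀ x y : L, B x y = B y x)
    (F : L → L)
    (hF : ∀ y z : L, B (F y) z = B y (bracket y z))
    (v : L)
    (hskew : ∀ x y : L, B (bracket v x) y = - B x (bracket v y))
    (I : Set ℝ) (hI : I.OrdConnected)
    (γ : ℝ → L)
    (hγ : ∀ s ∈ I, HasDerivWithinAt γ (F (γ s)) I s) :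
    (∀ s₁ ∈ I, ∀ s₂ ∈ I, B (γ s₁) v = B (γ s₂) v) ∧ (∀ y : L, B (F y) v = 0) := by
  have htangent : ∀ y : L, B (F y) v = 0 := fun y => by
    have hneg : bracket y v = -bracket v y := by
      have h := hanti (y + v)
      simp only [map_add, LinearMap.add_apply, hanti, zero_add, add_zero] at h
      exact eq_neg_of_add_eq_zero_right h
    have h := hskew y y
    rw [hBsymm] at h
    rw [hF, hneg, map_neg]
    linarith
  refine ⟨fun s₁ h₁ s₂ h₂ => ?_, htangent⟩
  have hderiv : ∀ s ∈ I, HasDerivWithinAt (fun t => B (γ t) v) 0 I s := fun s hs => by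
    rw [← htangent (γ s)]
    exact
      (LinearMap.toContinuousLinearMap (B.flip v)).hasFDerivAt.comp_hasDerivWithinAt s (hγ s hs)
  have h := hI.convex.norm_image_sub_le_of_norm_hasDerivWithin_le (C := 0) hderiv
    (fun _ _ => norm_zero.le) h₂ h₁
  rwa [zero_mul, norm_le_zero_iff, sub_eq_zero] at h
end

section
/- Let 𝔤 be a finite-dimensional real Lie algebra, regarded also as a normed real vector space, let B be a nondegenerate symmetric bilinear form on 𝔤, and let F : 𝔤 → 𝔤 satisfy B(F(y), z) = B(y, [y, z]) for all y, z ∈ 𝔤. Suppose v ∈ 𝔤 is nonzero with B(v, v) = 0, ad_v is skew-symmetric with respect to B (B([v, x], y) = −B(x, [v, y]) for all x, y), and the restriction of B to the hyperplane v^⊥ = {y ∈ 𝔤 : B(y, v) = 0} is positive semidefinite (B(y, y) ≥ 0 for all y ∈ v^⊥). Then for every y₀ ∈ v^⊥ there exists a curve γ : ℝ → 𝔤, defined on all of ℝ, with γ(0) = y₀ and γ'(s) = F(γ(s)) for all s ∈ ℝ. (Equivalently: geodesics orthogonal to the left-invariant null Killing field generated by v are complete.) -/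
open Set Metric Manifold

section GlobalExistence

variable {E : Type*} [NormedAddCommGroup E] [NormedSpace ℝ E]

/-- Solutions of an autonomous `C¹` equation on all bounded intervals glue to a global solution. -/
lemma exists_hasDerivAt_of_forall_Ioo {F : E → E} (hF : ContDiff ℝ 1 F) (x : E)
    (h : ∀ T : ℝ, ∃ γ : ℝ → E, γ 0 = x ∧ ∀ t ∈ Ioo (-T) T, HasDerivAt γ (F (γ t)) t) :
    ∃ γ : ℝ → E, γ 0 = x ∧ ∀ t, HasDerivAt γ (F (γ t)) t := by
  have hsec : ContMDiff 𝓘(ℝ, E) 𝓘(ℝ, E).tangent 1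
      (fun y ↦ (⟨y, F y⟩ : TangentBundle 𝓘(ℝ, E) E)) :=
    contMDiff_vectorSpace_iff_contDiff.2 hF
  obtain ⟨γ, h0, hγ⟩ :=
    (exists_isMIntegralCurve_iff_exists_isMIntegralCurveOn_Ioo hsec x).2 fun T ↦ by
      obtain ⟨γ, h0, hγ⟩ := h T
      exact ⟨γ, h0, fun t ht ↦ (hγ t ht).hasFDerivAt.hasMFDerivAt.hasMFDerivWithinAt⟩
  refine ⟨γ, h0, fun t ↦ ?_⟩
  have hd : HasFDerivAt γ ((1 : ℝ →L[ℝ] ℝ).smulRight (F (γ t))) t :=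
    hasMFDerivAt_iff_hasFDerivAt.1 (hγ t)
  simpa using hd.hasDerivAt

variable [FiniteDimensional ℝ E]

/-- A compactly supported `C¹` vector field is complete. -/
lemma exists_hasDerivAt_of_hasCompactSupport {G : E → E} (hG : ContDiff ℝ 1 G)
    (hsupp : HasCompactSupport G) (x : E) :
    ∃ γ : ℝ → E, γ 0 = x ∧ ∀ t, HasDerivAt γ (G (γ t)) t := by
  obtain ⟨K, hK⟩ := hG.lipschitzWith_of_hasCompactSupport hsupp one_ne_zero
  obtain ⟨C, hC⟩ := hsupp.exists_bound_of_continuous hG.continuous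
  refine exists_hasDerivAt_of_forall_Ioo hG x fun T ↦ ?_
  have hT : (0 : ℝ) ∈ Icc (-|T|) |T| := by simp
  have hPL : IsPicardLindelof (fun _ ↦ G) (⟨0, hT⟩ : Icc (-|T|) |T|) x
      (C.toNNReal * |T|.toNNReal) 0 C.toNNReal K := by
    refine .of_time_independent (fun y _ ↦ (hC y).trans (Real.le_coe_toNNReal C))
      hK.lipschitzOnWith ?_
    simp
  obtain ⟨γ, h0, hγ⟩ := hPL.exists_eq_forall_mem_Icc_hasDerivWithinAt₀
  refine ⟨γ, h0, fun t ht ↦ ?_⟩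
  have hle := le_abs_self T
  exact (hγ t ⟨by linarith [ht.1], by linarith [ht.2]⟩).hasDerivAt
    (Icc_mem_nhds (by linarith [ht.1]) (by linarith [ht.2]))

/-- If the solutions of all time-rescaled equations `γ' = φ(γ) F(γ)`, `0 ≤ φ ≤ 1`, starting at `x`
are bounded on bounded intervals uniformly in `φ`, then `F` has a global solution through `x`. -/
lemma exists_hasDerivAt_of_apriori_bound {F : E → E} (hF : ContDiff ℝ 1 F) (x : E)
    (h : ∀ T : ℝ, ∃ R : ℝ, ∀ (φ : E → ℝ) (γ : ℝ → E), (∀ y, |φ y| ≤ 1) → γ 0 = x →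
      (∀ t, HasDerivAt γ (φ (γ t) • F (γ t)) t) → ∀ t, |t| ≤ T → ‖γ t‖ ≤ R) :
    ∃ γ : ℝ → E, γ 0 = x ∧ ∀ t, HasDerivAt γ (F (γ t)) t := by
  refine exists_hasDerivAt_of_forall_Ioo hF x fun T ↦ ?_
  obtain ⟨R, hR⟩ := h T
  let φ : ContDiffBump (0 : E) := ⟨|R| + 1, |R| + 2, by positivity, by linarith⟩
  obtain ⟨γ, h0, hγ⟩ := exists_hasDerivAt_of_hasCompactSupport (G := fun y ↦ φ y • F y)
    (φ.contDiff.smul hF) φ.hasCompactSupport.smul_right x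
  refine ⟨γ, h0, fun t ht ↦ (hγ t).congr_deriv ?_⟩
  have hb : ‖γ t‖ ≤ R := hR φ γ (fun y ↦ abs_le.2 ⟨by linarith [φ.nonneg (x := y)], φ.le_one⟩)
    h0 hγ t (abs_le.2 ⟨ht.1.le, ht.2.le⟩)
  have hone : φ (γ t) = 1 := φ.one_of_mem_closedBall <| by
    simpa [φ] using hb.trans ((le_abs_self R).trans (by linarith))
  simp [hone]

end GlobalExistence

/-- Two-sided Grönwall inequality for a function on the whole line. -/
lemma abs_le_gronwallBound_of_hasDerivAt {f f' : ℝ → ℝ} {K ε : ℝ}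
    (hf : ∀ t, HasDerivAt f (f' t) t) (hbound : ∀ t, |f' t| ≤ K * |f t| + ε) (t : ℝ) :
    |f t| ≤ gronwallBound |f 0| K ε |t| := by
  have forward : ∀ {g g' : ℝ → ℝ}, (∀ s, HasDerivAt g (g' s) s) →
      (∀ s, |g' s| ≤ K * |g s| + ε) → ∀ s, 0 ≤ s → |g s| ≤ gronwallBound |g 0| K ε s := by
    intro g g' hg hb s hs
    simpa using norm_le_gronwallBound_of_norm_deriv_right_le (a := 0) (b := s)
      (fun u _ ↦ (hg u).continuousAt.continuousWithinAt) (fun u _ ↦ (hg u).hasDerivWithinAt)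
      le_rfl (fun u _ ↦ hb u) s ⟨hs, le_rfl⟩
  rcases le_total 0 t with ht | ht
  · simpa [abs_of_nonneg ht] using forward hf hbound t ht
  · have hg : ∀ s, HasDerivAt (fun s ↦ f (-s)) (-f' (-s)) s := fun s ↦
      ((hf (-s)).comp s (hasDerivAt_neg s)).congr_deriv (by simp)
    simpa [abs_of_nonpos ht] using forward hg (fun s ↦ by simpa using hbound (-s)) (-t) (by linarith)

/-- If `B` is nondegenerate and positive semidefinite on `v^⊥`, and `B v w = 1`, then `B` is
positive definite on `v^⊥ ∩ w^⊥`. -/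
lemma pos_of_orthogonal_of_semidef {L : Type*} [AddCommGroup L] [Module ℝ L]
    {B : LinearMap.BilinForm ℝ L}
    (hBsymm : ∀ x y : L, B x y = B y x) (hBnondeg : ∀ x : L, (∀ y : L, B x y = 0) → x = 0)
    {v w : L} (hsemidef : ∀ y : L, B y v = 0 → 0 ≤ B y y) (hw : B v w = 1)
    {x : L} (hxv : B x v = 0) (hxw : B x w = 0) (hx : x ≠ 0) : 0 < B x x := by
  refine (hsemidef x hxv).lt_of_ne fun hnull ↦ hx (hBnondeg x fun u ↦ ?_)
  have horth : ∀ z, B z v = 0 → B x z = 0 := by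
    intro z hz
    have hline : ∀ t : ℝ, 0 ≤ 2 * t * B x z + B z z := fun t ↦ by
      have h := hsemidef (t • x + z) (by simp [hxv, hz])
      simp only [map_add, map_smul, LinearMap.add_apply, LinearMap.smul_apply, smul_eq_mul,
        ← hnull, hBsymm z x] at h
      linarith
    by_contra hne
    have h := hline (-(B z z + 1) / (2 * B x z))
    have : 2 * (-(B z z + 1) / (2 * B x z)) * B x z = -(B z z + 1) := by field_simp
    linarith
  have h := horth (u - B u v • w) (by simp [hBsymm w v, hw])
  simpa [hxw] using h

section BilinearForm

variable {L : Type*} [NormedAddCommGroup L] [NormedSpace ℝ L] [FiniteDimensional ℝ L]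

/-- The `B`-sublevel sets in a subspace on which `B` is positive definite are bounded. -/
lemma exists_norm_le_of_posDef_on (B : LinearMap.BilinForm ℝ L) (S : Submodule ℝ L)
    (hpos : ∀ x ∈ S, x ≠ 0 → 0 < B x x) (e : ℝ) :
    ∃ r : ℝ, ∀ x ∈ S, B x x ≤ e → ‖x‖ ≤ r := by
  have hcont : Continuous fun x ↦ B x x := by
    change Continuous fun x ↦ B.toContinuousBilinearMap x x
    fun_prop
  have hcompact : IsCompact (sphere (0 : L) 1 ∩ S) :=
    (isCompact_sphere 0 1).inter_right S.closed_of_finiteDimensional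
  obtain ⟨c, hc, hmin⟩ : ∃ c > 0, ∀ x ∈ sphere (0 : L) 1 ∩ S, c ≤ B x x := by
    rcases (sphere (0 : L) 1 ∩ S).eq_empty_or_nonempty with hempty | hne
    · exact ⟨1, one_pos, by simp [hempty]⟩
    · obtain ⟨x₀, hx₀, hmin⟩ := hcompact.exists_isMinOn hne hcont.continuousOn
      refine ⟨B x₀ x₀, hpos x₀ hx₀.2 fun h ↦ ?_, fun x hx ↦ hmin hx⟩
      simpa [h] using hx₀.1
  refine ⟨√(e / c), fun x hx he ↦ Real.le_sqrt_of_sq_le ?_⟩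
  rw [le_div_iff₀ hc]
  rcases eq_or_ne x 0 with rfl | hx0
  · simpa using he
  have hn : 0 < ‖x‖ := norm_pos_iff.2 hx0
  have hmem : ‖x‖⁻¹ • x ∈ sphere (0 : L) 1 ∩ S :=
    ⟨by simp [norm_smul, hn.ne'], S.smul_mem _ hx⟩
  have hle := hmin _ hmem
  simp only [map_smul, LinearMap.smul_apply, smul_eq_mul] at hle
  have hexp : B x x = ‖x‖ ^ 2 * (‖x‖⁻¹ * (‖x‖⁻¹ * B x x)) := by field_simp
  nlinarith [sq_nonneg ‖x‖]

/-- An Euler–Arnold field of a nondegenerate form is smooth. -/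
lemma contDiff_eulerArnold {bracket : L →ₗ[ℝ] L →ₗ[ℝ] L} {B : LinearMap.BilinForm ℝ L}
    (hB : B.Nondegenerate) {F : L → L} (hF : ∀ y z : L, B (F y) z = B y (bracket y z)) :
    ContDiff ℝ 1 F := by
  let b := Module.finBasis ℝ L
  have hsum : F = fun y ↦ ∑ i, B.toContinuousBilinearMap y
      (bracket.toContinuousBilinearMap y (b i)) • B.dualBasis hB b i := by
    funext y
    rw [← (B.dualBasis hB b).sum_repr (F y)]
    simp [LinearMap.BilinForm.dualBasis_repr_apply, hF]
  rw [hsum]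
  fun_prop

end BilinearForm


/-- **Completeness of Euler–Arnold solutions orthogonal to a null Killing vector.**
Let `L` be a finite-dimensional real Lie algebra regarded also as a normed real
vector space, `B` a nondegenerate symmetric bilinear form, `F` an Euler–Arnold
field for `(L, B)`. Suppose `v ≠ 0` is null (`B v v = 0`), `ad_v` is
skew-symmetric with respect to `B`, and `B` is positive semidefinite on the
hyperplane `v^⊥`. Then every Euler–Arnold solution starting in `v^⊥` extends to
all of `ℝ`: geodesics orthogonal to the null Killing field generated by `v`
are complete. -/
theorem euler_arnold_complete_orthogonal_to_null_killing
    {L : Type*} [NormedAddCommGroup L] [NormedSpace ℝ L] [FiniteDimensional ℝ L]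
    (bracket : L →ₗ[ℝ] L →ₗ[ℝ] L)
    (hanti : ∀ x : L, bracket x x = 0)
    (hjacobi : ∀ x y z : L,
      bracket x (bracket y z) = bracket (bracket x y) z + bracket y (bracket x z))
    (B : LinearMap.BilinForm ℝ L)
    (hBsymm : ∀ x y : L, B x y = B y x)
    (hBnondeg : ∀ x : L, (∀ y : L, B x y = 0) → x = 0)
    (F : L → L)
    (hF : ∀ y z : L, B (F y) z = B y (bracket y z))
    (v : L) (hv : v ≠ 0) (hvnull : B v v = 0)
    (hskew : ∀ x y : L, B (bracket v x) y = - B x (bracket v y))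
    (hsemidef : ∀ y : L, B y v = 0 → 0 ≤ B y y) :
    ∀ y₀ : L, B y₀ v = 0 →
      ∃ γ : ℝ → L, γ 0 = y₀ ∧ ∀ s : ℝ, HasDerivAt γ (F (γ s)) s := by
  intro y₀ hy₀
  have hB : B.Nondegenerate :=
    ⟨hBnondeg, fun y hy ↦ hBnondeg y fun x ↦ (hBsymm y x).trans (hy x)⟩
  obtain ⟨w, hw⟩ : ∃ w, B v w = 1 := by
    obtain ⟨u, hu⟩ : ∃ u, B v u ≠ 0 := by
      by_contra! h
      exact hv (hBnondeg v h)
    exact ⟨(B v u)⁻¹ • u, by simp [hu]⟩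
  have hFv : ∀ y, B (F y) v = 0 := fun y ↦ by
    have hswap : bracket y v = -bracket v y := by
      have h := hanti (y + v)
      simp only [map_add, LinearMap.add_apply, hanti, zero_add, add_zero] at h
      rw [add_comm] at h
      exact eq_neg_of_add_eq_zero_left h
    have h := hskew y y
    rw [hBsymm] at h
    rw [hF, hswap, map_neg]
    linarith
  have hFself : ∀ y, B (F y) y = 0 := fun y ↦ by simp [hF, hanti]
  let S : Submodule ℝ L := LinearMap.ker (B.flip v) ⊓ LinearMap.ker (B.flip w)
  have hS : ∀ {x}, x ∈ S ↔ B x v = 0 ∧ B x w = 0 := by simp [S]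
  obtain ⟨r, hr⟩ := exists_norm_le_of_posDef_on B S
    (fun x hx ↦ pos_of_orthogonal_of_semidef hBsymm hBnondeg hsemidef hw (hS.1 hx).1 (hS.1 hx).2)
    (B y₀ y₀)
  obtain ⟨K, hK⟩ := (isCompact_closedBall (0 : L) r).exists_bound_of_continuousOn
    (f := fun x ↦ B v (bracket x w) + B x (bracket v w)) (by
      change ContinuousOn (fun x ↦ B.toContinuousBilinearMap v
        (bracket.toContinuousBilinearMap x w) + B.toContinuousBilinearMap x (bracket v w)) _
      fun_prop)
  obtain ⟨ε, hε⟩ := (isCompact_closedBall (0 : L) r).exists_bound_of_continuousOn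
    (f := fun x ↦ B x (bracket x w)) (by
      change ContinuousOn (fun x ↦ B.toContinuousBilinearMap x
        (bracket.toContinuousBilinearMap x w)) _
      fun_prop)
  refine exists_hasDerivAt_of_apriori_bound (contDiff_eulerArnold hB hF) y₀ fun T ↦
    ⟨gronwallBound |B y₀ w| K ε T * ‖v‖ + r, fun φ γ hφ h0 hγ t ht ↦ ?_⟩
  have hlin : ∀ z s, HasDerivAt (fun s ↦ B (γ s) z) (φ (γ s) * B (F (γ s)) z) s := fun z s ↦
    ((B.flip z).toContinuousLinearMap.hasFDerivAt.comp_hasDerivAt s (hγ s)).congr_deriv (by simp)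
  have hortho : ∀ s, B (γ s) v = 0 := fun s ↦ by
    rw [← hy₀, ← h0]
    exact is_const_of_deriv_eq_zero (fun s ↦ (hlin v s).differentiableAt)
      (fun s ↦ by rw [(hlin v s).deriv, hFv, mul_zero]) s 0
  have henergy : ∀ s, B (γ s) (γ s) = B y₀ y₀ := fun s ↦ by
    have hd : ∀ s, HasDerivAt (fun s ↦ B (γ s) (γ s)) 0 s := fun s ↦ by
      have h := (B.toContinuousBilinearMap.hasFDerivAt.comp_hasDerivAt s (hγ s)).clm_apply (hγ s)
      refine h.congr_deriv ?_
      simp [hFself, hBsymm (γ s) (F (γ s))]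
    rw [← h0]
    exact is_const_of_deriv_eq_zero (fun s ↦ (hd s).differentiableAt) (fun s ↦ (hd s).deriv) s 0
  have hdecomp : ∀ s, ∃ x, γ s = B (γ s) w • v + x ∧ ‖x‖ ≤ r := fun s ↦ by
    refine ⟨γ s - B (γ s) w • v, by abel, hr _ (hS.2 ?_) ?_⟩
    · simp [hortho, hvnull, hw]
    · simp [hortho, hvnull, henergy, hBsymm v (γ s)]
  have hvw : B v (bracket v w) = 0 := by simpa [hanti] using hskew v w
  have hgrowth : ∀ s, |φ (γ s) * B (F (γ s)) w| ≤ K * |B (γ s) w| + ε := fun s ↦ by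
    obtain ⟨x, hx, hxr⟩ := hdecomp s
    have hmem : x ∈ closedBall (0 : L) r := by simpa using hxr
    set a := B (γ s) w
    have hval : B (F (γ s)) w = (B v (bracket x w) + B x (bracket v w)) * a
        + B x (bracket x w) := by
      rw [hF, hx]
      simp only [map_add, map_smul, LinearMap.add_apply, LinearMap.smul_apply, smul_eq_mul, hvw]
      ring
    calc |φ (γ s) * B (F (γ s)) w| ≤ |B (F (γ s)) w| := by
          rw [abs_mul]
          exact mul_le_of_le_one_left (abs_nonneg _) (hφ _)
      _ ≤ |B v (bracket x w) + B x (bracket v w)| * |a| + |B x (bracket x w)| := by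
          rw [hval, ← abs_mul]
          exact abs_add_le _ _
      _ ≤ K * |a| + ε := by
          gcongr
          · exact hK x hmem
          · exact hε x hmem
  obtain ⟨x, hx, hxr⟩ := hdecomp t
  have hmem : (0 : L) ∈ closedBall (0 : L) r := by
    simpa using (norm_nonneg x).trans hxr
  have hbound : |B (γ t) w| ≤ gronwallBound |B y₀ w| K ε T := by
    have h := abs_le_gronwallBound_of_hasDerivAt (hlin w) hgrowth t
    rw [h0] at h
    exact h.trans (gronwallBound_mono (abs_nonneg _) ((norm_nonneg _).trans (hε 0 hmem))
      ((norm_nonneg _).trans (hK 0 hmem)) ht)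
  calc ‖γ t‖ ≤ ‖B (γ t) w • v‖ + ‖x‖ := by
        conv_lhs => rw [hx]
        exact norm_add_le _ _
    _ ≤ gronwallBound |B y₀ w| K ε T * ‖v‖ + r := by
        rw [norm_smul, Real.norm_eq_abs]
        gcongr
end

section
/- Let F₃ : ℝ³ → ℝ³ be F₃(t,x,v) = (−x·v, 0, t·v), and let q₃ be the quadratic form q₃(t,x,v) = t² + 2·x·v. The curve γ(s) = (2/(1−s), 1, −2/(1−s)²), defined for s ∈ (−∞, 1), satisfies γ'(s) = F₃(γ(s)) for every s < 1, is lightlike in the sense that q₃(γ(s)) = 0 for all s < 1, and its norm ‖γ(s)‖ tends to +∞ as s → 1⁻. -/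
/-- The Euler–Arnold field `F₃(t,x,v) = (−x·v, 0, t·v)`. -/
def F3 : ℝ × ℝ × ℝ → ℝ × ℝ × ℝ :=
  fun p => (-(p.2.1 * p.2.2), 0, p.1 * p.2.2)

/-- The incomplete lightlike solution `γ(s) = (2/(1−s), 1, −2/(1−s)²)`. -/
noncomputable def γCP : ℝ → ℝ × ℝ × ℝ :=
  fun s => (2 / (1 - s), 1, -2 / (1 - s) ^ 2)

/-- The curve `γ(s) = (2/(1−s), 1, −2/(1−s)²)`, defined for `s < 1`, is an
integral curve of the Euler–Arnold field `F₃`, is lightlike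
(`t² + 2·x·v = 0` along it), and its norm blows up as `s → 1⁻`. -/
theorem incomplete_lightlike_euler_arnold_solution :
    (∀ s : ℝ, s < 1 → HasDerivAt γCP (F3 (γCP s)) s) ∧
    (∀ s : ℝ, s < 1 →
      (γCP s).1 ^ 2 + 2 * (γCP s).2.1 * (γCP s).2.2 = 0) ∧
    Filter.Tendsto (fun s => ‖γCP s‖) (nhdsWithin 1 (Set.Iio 1)) Filter.atTop := by
  refine ⟨fun s hs => ?_, fun s hs => ?_, ?_⟩
  · have h : 1 - s ≠ 0 := (sub_pos.2 hs).ne'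
    have hsub : HasDerivAt (fun s : ℝ => 1 - s) (-1) s := (hasDerivAt_id' s).const_sub 1
    have ht : HasDerivAt (fun s : ℝ => 2 / (1 - s)) (F3 (γCP s)).1 s := by
      refine ((hasDerivAt_const s (2 : ℝ)).fun_div hsub h).congr_deriv ?_
      simp only [F3, γCP]
      field_simp
      ring
    have hv : HasDerivAt (fun s : ℝ => -2 / (1 - s) ^ 2) (F3 (γCP s)).2.2 s := by
      refine ((hasDerivAt_const s (-2 : ℝ)).fun_div (hsub.fun_pow 2) (pow_ne_zero 2 h)).congr_deriv ?_
      simp only [F3, γCP]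
      field_simp
      ring
    exact ht.prodMk ((hasDerivAt_const s (1 : ℝ)).prodMk hv)
  · have h : 1 - s ≠ 0 := (sub_pos.2 hs).ne'
    simp only [γCP]
    field_simp
    ring
  · have hsub : Filter.Tendsto (fun s : ℝ => 1 - s) (nhdsWithin 1 (Set.Iio 1))
        (nhdsWithin 0 (Set.Ioi 0)) := by
      refine tendsto_nhdsWithin_iff.2 ⟨?_, ?_⟩
      · exact ((continuous_const.sub continuous_id).tendsto' (1 : ℝ) 0 (sub_self 1)).mono_left
          nhdsWithin_le_nhds
      · filter_upwards [self_mem_nhdsWithin] with s hs using sub_pos.2 (Set.mem_Iio.1 hs)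
    have ht : Filter.Tendsto (fun s : ℝ => (γCP s).1) (nhdsWithin 1 (Set.Iio 1)) Filter.atTop :=
      (tendsto_inv_nhdsGT_zero.comp hsub).const_mul_atTop two_pos
    exact Filter.tendsto_atTop_mono (fun s => (le_abs_self _).trans (norm_fst_le (γCP s))) ht
end

section
/- Let F₄ : ℝ⁴ → ℝ⁴ be F₄(t,x,y,v) = (−x·v + y², 0, −t·y, t·v). If I ⊆ ℝ is an interval and γ = (t, x, y, v) : I → ℝ⁴ is differentiable with γ'(s) = F₄(γ(s)) for every s ∈ I, and y(s₀) = 0 for some s₀ ∈ I, then y(s) = 0 for every s ∈ I. (The hyperplane {y = 0}, corresponding to the subalgebra aff(ℝ) ⊕ ℝ, is invariant under the Euler–Arnold flow, i.e. totally geodesic.) -/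
/-- The Euler–Arnold field `F₄(t,x,y,v) = (−x·v + y², 0, −t·y, t·v)`. -/
def F4 : ℝ × ℝ × ℝ × ℝ → ℝ × ℝ × ℝ × ℝ :=
  fun p => (-(p.2.1 * p.2.2.2) + p.2.2.1 ^ 2, 0, -(p.1 * p.2.2.1), p.1 * p.2.2.2)

/-- A solution on `[a, b]` of the linear equation `f' = c f` with `c` continuous
vanishes identically if it vanishes at `a`. -/
theorem eq_zero_of_hasDerivWithinAt_mul_Icc_right {f c : ℝ → ℝ} {a b : ℝ}
    (hc : ContinuousOn c (Set.Icc a b))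
    (hf : ∀ s ∈ Set.Icc a b, HasDerivWithinAt f (c s * f s) (Set.Icc a b) s)
    (ha : f a = 0) : ∀ s ∈ Set.Icc a b, f s = 0 := by
  obtain ⟨K, hK⟩ := isCompact_Icc.exists_bound_of_continuousOn hc
  refine eq_zero_of_abs_deriv_le_mul_abs_self_of_eq_zero_right (K := K)
    (fun s hs => (hf s hs).continuousWithinAt)
    (fun s hs => (hf s (Set.Ico_subset_Icc_self hs)).mono_of_mem_nhdsWithin
      (Icc_mem_nhdsGE_of_mem hs)) ha fun s hs => ?_
  rw [norm_mul]
  gcongr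
  exact hK s (Set.Ico_subset_Icc_self hs)

/-- A solution on `[a, b]` of the linear equation `f' = c f` with `c` continuous
vanishes identically if it vanishes at `b`. -/
theorem eq_zero_of_hasDerivWithinAt_mul_Icc_left {f c : ℝ → ℝ} {a b : ℝ}
    (hc : ContinuousOn c (Set.Icc a b))
    (hf : ∀ s ∈ Set.Icc a b, HasDerivWithinAt f (c s * f s) (Set.Icc a b) s)
    (hb : f b = 0) : ∀ s ∈ Set.Icc a b, f s = 0 := by
  have hmaps : Set.MapsTo (fun s : ℝ => -s) (Set.Icc (-b) (-a)) (Set.Icc a b) :=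
    fun s hs => ⟨by linarith [hs.2], by linarith [hs.1]⟩
  have key := eq_zero_of_hasDerivWithinAt_mul_Icc_right (f := fun s => f (-s))
    (c := fun s => -c (-s)) (a := -b) (b := -a)
    (hc.comp continuous_neg.continuousOn hmaps).neg
    (fun s hs => by
      have h := (hf (-s) (hmaps hs)).comp s (hasDerivAt_neg s).hasDerivWithinAt hmaps
      exact h.congr_deriv (by ring))
    (by simpa using hb)
  intro s hs
  simpa using key (-s) ⟨neg_le_neg hs.2, neg_le_neg hs.1⟩

/-- A solution on an interval of the linear equation `f' = c f` with `c` continuous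
vanishes identically if it vanishes at one point. -/
theorem eq_zero_of_hasDerivWithinAt_mul {f c : ℝ → ℝ} {I : Set ℝ} (hI : I.OrdConnected)
    (hc : ContinuousOn c I) (hf : ∀ s ∈ I, HasDerivWithinAt f (c s * f s) I s)
    {s₀ : ℝ} (hs₀ : s₀ ∈ I) (h₀ : f s₀ = 0) : ∀ s ∈ I, f s = 0 := by
  intro s hs
  rcases le_total s₀ s with h | h
  · have hsub := hI.out hs₀ hs
    exact eq_zero_of_hasDerivWithinAt_mul_Icc_right (hc.mono hsub)
      (fun r hr => (hf r (hsub hr)).mono hsub) h₀ s ⟨h, le_rfl⟩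
  · have hsub := hI.out hs hs₀
    exact eq_zero_of_hasDerivWithinAt_mul_Icc_left (hc.mono hsub)
      (fun r hr => (hf r (hsub hr)).mono hsub) h₀ s ⟨le_rfl, h⟩

/-- The hyperplane `{y = 0}`, corresponding to the subalgebra `aff(ℝ) ⊕ ℝ`,
is invariant under the Euler–Arnold flow of `F₄` (it is totally geodesic):
if an integral curve of `F₄` on an interval `I` has vanishing `y`-coordinate at
one point of `I`, then its `y`-coordinate vanishes on all of `I`. -/
theorem hyperplane_y_eq_zero_invariant
    (I : Set ℝ) (hI : I.OrdConnected)
    (γ : ℝ → ℝ × ℝ × ℝ × ℝ)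
    (hγ : ∀ s ∈ I, HasDerivWithinAt γ (F4 (γ s)) I s)
    (s₀ : ℝ) (hs₀ : s₀ ∈ I) (hy₀ : (γ s₀).2.2.1 = 0) :
    ∀ s ∈ I, (γ s).2.2.1 = 0 := by
  refine eq_zero_of_hasDerivWithinAt_mul (f := fun s => (γ s).2.2.1) (c := fun s => -(γ s).1)
    hI ?_ (fun s hs => ?_) hs₀ hy₀
  · exact (continuous_fst.comp_continuousOn fun s hs => (hγ s hs).continuousWithinAt).neg
  · have h := (hγ s hs).hasFDerivWithinAt.snd.snd.fst.hasDerivWithinAt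
    exact h.congr_deriv (by simp [F4])
end

section
/- Let ε > 0, let T > 0 be a real number, and let b : ℝ → ℝ be differentiable at every point of [0, T) with b(0) > 0 and with derivative satisfying b'(s) ≥ (ε/2)·b(s)² for every s ∈ [0, T). Then T ≤ 2/(ε·b(0)). -/
/-- A solution of `b' ≥ c * b ^ 2` with `c ≥ 0` on `[0, T)` is monotone there. -/
theorem monotoneOn_of_riccati {c T : ℝ} (hc : 0 ≤ c) {b b' : ℝ → ℝ}
    (hderiv : ∀ s ∈ Set.Ico (0 : ℝ) T, HasDerivAt b (b' s) s)
    (hineq : ∀ s ∈ Set.Ico (0 : ℝ) T, c * b s ^ 2 ≤ b' s) :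
    MonotoneOn b (Set.Ico 0 T) :=
  monotoneOn_of_hasDerivWithinAt_nonneg (convex_Ico 0 T)
    (fun s hs => (hderiv s hs).continuousAt.continuousWithinAt)
    (fun s hs => (hderiv s (interior_subset hs)).hasDerivWithinAt)
    (fun s hs => (mul_nonneg hc (sq_nonneg _)).trans (hineq s (interior_subset hs)))

/-- For a positive solution of `b' ≥ c * b ^ 2` on `[0, T)`, the function `s ↦ 1 / b s + c * s`
is antitone there. -/
theorem antitoneOn_inv_add_of_riccati {c T : ℝ} {b b' : ℝ → ℝ}
    (hpos : ∀ s ∈ Set.Ico (0 : ℝ) T, 0 < b s)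
    (hderiv : ∀ s ∈ Set.Ico (0 : ℝ) T, HasDerivAt b (b' s) s)
    (hineq : ∀ s ∈ Set.Ico (0 : ℝ) T, c * b s ^ 2 ≤ b' s) :
    AntitoneOn (fun s => (b s)⁻¹ + c * s) (Set.Ico 0 T) := by
  have hd : ∀ s ∈ Set.Ico (0 : ℝ) T,
      HasDerivAt (fun s => (b s)⁻¹ + c * s) (-b' s / b s ^ 2 + c * 1) s := fun s hs =>
    ((hderiv s hs).fun_inv (hpos s hs).ne').add ((hasDerivAt_id' s).const_mul c)
  refine antitoneOn_of_hasDerivWithinAt_nonpos (convex_Ico 0 T)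
    (fun s hs => (hd s hs).continuousAt.continuousWithinAt)
    (fun s hs => (hd s (interior_subset hs)).hasDerivWithinAt) fun s hs => ?_
  have hs' := interior_subset hs
  have h : c ≤ b' s / b s ^ 2 := (le_div_iff₀ (pow_pos (hpos s hs') 2)).2 (hineq s hs')
  rw [neg_div]
  linarith


/-- **Riccati comparison / finite-time blow-up.**
If `ε > 0`, `T > 0`, and `b : ℝ → ℝ` is differentiable at every point of
`[0, T)` with `b 0 > 0` and derivative `b'` satisfying
`b' s ≥ (ε/2)·(b s)²` on `[0, T)`, then `T ≤ 2/(ε · b 0)`. -/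
theorem riccati_blow_up (ε T : ℝ) (hε : 0 < ε) (hT : 0 < T)
    (b b' : ℝ → ℝ) (hb0 : 0 < b 0)
    (hderiv : ∀ s ∈ Set.Ico (0 : ℝ) T, HasDerivAt b (b' s) s)
    (hineq : ∀ s ∈ Set.Ico (0 : ℝ) T, ε / 2 * (b s) ^ 2 ≤ b' s) :
    T ≤ 2 / (ε * b 0) := by
  have h0 : (0 : ℝ) ∈ Set.Ico 0 T := ⟨le_rfl, hT⟩
  have hmono := monotoneOn_of_riccati (half_pos hε).le hderiv hineq
  have hpos : ∀ s ∈ Set.Ico (0 : ℝ) T, 0 < b s := fun s hs =>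
    hb0.trans_le (hmono h0 hs hs.1)
  have hanti := antitoneOn_inv_add_of_riccati hpos hderiv hineq
  refine le_of_forall_lt_imp_le_of_dense fun s hsT => ?_
  rcases le_or_gt 0 s with hs0 | hs0
  · have h := hanti h0 ⟨hs0, hsT⟩ hs0
    have hinv := inv_pos.2 (hpos s ⟨hs0, hsT⟩)
    have hle : ε / 2 * s ≤ (b 0)⁻¹ := by
      simp only [mul_zero, add_zero] at h
      linarith
    have hmul := mul_le_mul_of_nonneg_right hle hb0.le
    rw [inv_mul_cancel₀ hb0.ne'] at hmul
    rw [le_div_iff₀ (mul_pos hε hb0)]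
    linarith
  · exact hs0.le.trans (by positivity)
end

section
/- Consider the planar system (S): x'(s) = b(s)·cos(x(s)) + sin(x(s)) and b'(s) = (1/2)·sin(x(s))·b(s)² − cos(x(s))·b(s). Let 0 < T ≤ ∞ and let x, b : [0, T) → ℝ be differentiable functions solving (S) on [0, T) with x(0) = π/2 and b(0) > 0. Then for every s ∈ [0, T): π/2 ≤ x(s) < π, b(s) > 0, and b'(s) > 0; in particular b is strictly increasing on [0, T). -/
/-- A differentiable function that starts below a barrier and has smaller derivative whenever it
touches the barrier stays below the barrier. -/
theorem le_barrier_of_hasDerivAt {f f' B B' : ℝ → ℝ} {S : ℝ} (hS : 0 ≤ S)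
    (hf : ∀ t ∈ Set.Icc 0 S, HasDerivAt f (f' t) t) (h0 : f 0 ≤ B 0)
    (hB : ∀ t, HasDerivAt B (B' t) t)
    (h : ∀ t ∈ Set.Icc 0 S, f t = B t → f' t < B' t) : f S ≤ B S :=
  image_le_of_deriv_right_lt_deriv_boundary
    (fun t ht => (hf t ht).continuousAt.continuousWithinAt)
    (fun t ht => (hf t (Set.Ico_subset_Icc_self ht)).hasDerivWithinAt) h0 hB
    (fun t ht => h t (Set.Ico_subset_Icc_self ht)) ⟨hS, le_rfl⟩

/-- A solution of `b' = g b` with `g` continuous and `b 0 > 0` remains positive. -/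
theorem pos_of_hasDerivAt_mul {b g : ℝ → ℝ} {S : ℝ} (hS : 0 ≤ S)
    (hg : ContinuousOn g (Set.Icc 0 S))
    (hb : ∀ t ∈ Set.Icc 0 S, HasDerivAt b (g t * b t) t) (hb0 : 0 < b 0) : 0 < b S := by
  obtain ⟨K, hK⟩ := isCompact_Icc.exists_bound_of_continuousOn hg
  have hle := le_barrier_of_hasDerivAt (f := fun t => -b t)
    (B := fun t => -(b 0 * Real.exp (-(K + 1) * t)))
    (B' := fun t => -(b 0 * (Real.exp (-(K + 1) * t) * (-(K + 1))))) hS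
    (fun t ht => (hb t ht).neg) (by simp)
    (fun t => by
      have h1 : HasDerivAt (fun t : ℝ => -(K + 1) * t) (-(K + 1)) t := by
        simpa using (hasDerivAt_id t).const_mul (-(K + 1))
      exact (h1.exp.const_mul (b 0)).neg)
    (fun t ht heq => by
      have hgt := neg_le_of_abs_le (hK t ht)
      have hpos : 0 < b 0 * Real.exp (-(K + 1) * t) := by positivity
      have hbt : b t = b 0 * Real.exp (-(K + 1) * t) := neg_injective heq
      rw [← mul_assoc, ← hbt]
      rw [← hbt] at hpos
      nlinarith)
  have hpos : 0 < b 0 * Real.exp (-(K + 1) * S) := by positivity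
  exact hpos.trans_le (neg_le_neg_iff.mp hle)


/-- **Band invariance for the reduced null-geodesic system.**
Consider the system `(S)`: `x' = b·cos x + sin x`, `b' = (1/2)·sin(x)·b² − cos(x)·b`.
For `0 < T ≤ ∞` and a solution `(x, b)` on `[0, T)` with `x 0 = π/2` and
`b 0 > 0`, one has `π/2 ≤ x s < π`, `b s > 0` and `b' s > 0` for every
`s ∈ [0, T)`; in particular `b` is strictly increasing on `[0, T)`. -/
theorem band_invariance (T : EReal) (hT : 0 < T)
    (x b : ℝ → ℝ)
    (hx : ∀ s : ℝ, 0 ≤ s → (s : EReal) < T →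
      HasDerivAt x (b s * Real.cos (x s) + Real.sin (x s)) s)
    (hb : ∀ s : ℝ, 0 ≤ s → (s : EReal) < T →
      HasDerivAt b (1 / 2 * Real.sin (x s) * (b s) ^ 2 - Real.cos (x s) * b s) s)
    (hx0 : x 0 = Real.pi / 2) (hb0 : 0 < b 0) :
    (∀ s : ℝ, 0 ≤ s → (s : EReal) < T →
      Real.pi / 2 ≤ x s ∧ x s < Real.pi ∧ 0 < b s ∧
        0 < 1 / 2 * Real.sin (x s) * (b s) ^ 2 - Real.cos (x s) * b s) ∧
    StrictMonoOn b {s : ℝ | 0 ≤ s ∧ (s : EReal) < T} := by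
  have hlt : ∀ {s t : ℝ}, (s : EReal) < T → t ≤ s → (t : EReal) < T := fun hs hts =>
    (EReal.coe_le_coe_iff.mpr hts).trans_lt hs
  have hbpos : ∀ s : ℝ, 0 ≤ s → (s : EReal) < T → 0 < b s := by
    intro s hs hsT
    refine pos_of_hasDerivAt_mul
      (g := fun t => 1 / 2 * Real.sin (x t) * b t - Real.cos (x t)) hs ?_ ?_ hb0
    · have hxc : ContinuousOn x (Set.Icc 0 s) := fun t ht =>
        (hx t ht.1 (hlt hsT ht.2)).continuousAt.continuousWithinAt
      have hbc : ContinuousOn b (Set.Icc 0 s) := fun t ht =>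
        (hb t ht.1 (hlt hsT ht.2)).continuousAt.continuousWithinAt
      fun_prop
    · intro t ht
      convert hb t ht.1 (hlt hsT ht.2) using 1
      ring
  have hxge : ∀ s : ℝ, 0 ≤ s → (s : EReal) < T → Real.pi / 2 ≤ x s := by
    intro s hs hsT
    have hle := le_barrier_of_hasDerivAt (f := fun t => -x t) (B := fun _ => -(Real.pi / 2))
      (B' := fun _ => 0) hs (fun t ht => (hx t ht.1 (hlt hsT ht.2)).neg) (by simp [hx0])
      (fun t => hasDerivAt_const t _)
      (fun t _ heq => by
        have hxt : x t = Real.pi / 2 := neg_injective heq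
        simp [hxt])
    exact neg_le_neg_iff.mp hle
  have hxle : ∀ s : ℝ, 0 ≤ s → (s : EReal) < T → x s ≤ Real.pi := by
    intro s hs hsT
    exact le_barrier_of_hasDerivAt (f := x) (B := fun _ => Real.pi)
      (B' := fun _ => 0) hs (fun t ht => hx t ht.1 (hlt hsT ht.2))
      (by rw [hx0]; linarith [Real.pi_pos])
      (fun t => hasDerivAt_const t _)
      (fun t ht heq => by
        have hbt := hbpos t ht.1 (hlt hsT ht.2)
        simpa [heq] using hbt)
  have hxlt : ∀ s : ℝ, 0 ≤ s → (s : EReal) < T → x s < Real.pi := by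
    intro s hs hsT
    refine (hxle s hs hsT).lt_of_ne fun heq => ?_
    have hs0 : 0 < s := hs.lt_of_ne fun h => by
      rw [← h, hx0] at heq
      linarith [Real.pi_pos]
    obtain ⟨r, hsr, hrT⟩ := EReal.lt_iff_exists_real_btwn.mp hsT
    have hmax : IsLocalMax x s := by
      filter_upwards [Ioo_mem_nhds hs0 (EReal.coe_lt_coe_iff.mp hsr)] with t ht
      rw [heq]
      exact hxle t ht.1.le (hlt hrT ht.2.le)
    have hzero := hmax.hasDerivAt_eq_zero (hx s hs hsT)
    have hbs := hbpos s hs hsT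
    simp [heq] at hzero
    exact hbs.ne' hzero
  have hderiv : ∀ s : ℝ, 0 ≤ s → (s : EReal) < T →
      0 < 1 / 2 * Real.sin (x s) * (b s) ^ 2 - Real.cos (x s) * b s := by
    intro s hs hsT
    have hbs := hbpos s hs hsT
    have hge := hxge s hs hsT
    have hsin : 0 < Real.sin (x s) :=
      Real.sin_pos_of_pos_of_lt_pi (by linarith [Real.pi_pos]) (hxlt s hs hsT)
    have hcos : Real.cos (x s) ≤ 0 :=
      Real.cos_nonpos_of_pi_div_two_le_of_le hge (by linarith [hxle s hs hsT, Real.pi_pos])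
    have h1 : 0 < 1 / 2 * Real.sin (x s) * (b s) ^ 2 := by positivity
    have h2 : Real.cos (x s) * b s ≤ 0 := mul_nonpos_of_nonpos_of_nonneg hcos hbs.le
    linarith
  refine ⟨fun s hs hsT => ⟨hxge s hs hsT, hxlt s hs hsT, hbpos s hs hsT, hderiv s hs hsT⟩, ?_⟩
  have hconv : Convex ℝ {s : ℝ | 0 ≤ s ∧ (s : EReal) < T} :=
    Set.OrdConnected.convex
      ⟨fun _ hs _ ht _ hr => ⟨hs.1.trans hr.1, hlt ht.2 hr.2⟩⟩
  refine strictMonoOn_of_deriv_pos hconv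
    (fun s hs => (hb s hs.1 hs.2).continuousAt.continuousWithinAt) fun s hs => ?_
  have hs' := interior_subset hs
  rw [(hb s hs'.1 hs'.2).deriv]
  exact hderiv s hs'.1 hs'.2
end

section
/- Consider the planar system (S): x'(s) = b(s)·cos(x(s)) + sin(x(s)) and b'(s) = (1/2)·sin(x(s))·b(s)² − cos(x(s))·b(s). Let 0 < T ≤ ∞ and let x, b : [0, T) → ℝ be differentiable functions solving (S) on [0, T) with x(0) = π/2 and b(0) > 0. Then there exists δ > 0 such that x(s) ≤ π − δ for every s ∈ [0, T); in particular sin(x(s)) ≥ sin(δ) > 0 for all s ∈ [0, T). -/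
open Set Filter Topology in
/-- A function that is nonnegative at `s`, with positive derivative there if it vanishes,
remains nonnegative immediately to the right of `s`. -/
theorem eventually_nonneg_right_of_hasDerivAt {g : ℝ → ℝ} {g' s : ℝ} (hg : HasDerivAt g g' s)
    (h0 : 0 ≤ g s) (hpos : g s = 0 → 0 < g') : ∀ᶠ t in 𝓝[>] s, 0 ≤ g t := by
  rcases h0.lt_or_eq with h | h
  · exact nhdsWithin_le_nhds ((hg.continuousAt.eventually_const_lt h).mono fun _ ht => ht.le)
  · have hslope : ∀ᶠ t in 𝓝[>] s, 0 < slope g s t :=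
      ((hasDerivAt_iff_tendsto_slope.1 hg).mono_left
        (nhdsWithin_mono _ fun _ ht => ne_of_gt ht)).eventually_const_lt (hpos h.symm)
    filter_upwards [hslope, self_mem_nhdsWithin] with t ht hst
    have hst' : 0 < t - s := sub_pos.2 hst
    rw [slope_def_field, ← h, sub_zero] at ht
    exact ((div_pos_iff_of_pos_right hst').1 ht).le

open Set Filter Topology in
/-- The region `π/2 ≤ x ≤ π - δ`, `b ≥ β` is forward invariant for the system `(S)` as soon as
`sin δ < β * cos δ`. -/
theorem geodesic_region_invariant {x b : ℝ → ℝ} {δ β t : ℝ} (ht : 0 ≤ t)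
    (hx : ∀ s ∈ Icc 0 t, HasDerivAt x (b s * Real.cos (x s) + Real.sin (x s)) s)
    (hb : ∀ s ∈ Icc 0 t,
      HasDerivAt b (1 / 2 * Real.sin (x s) * (b s) ^ 2 - Real.cos (x s) * b s) s)
    (hδ : 0 < δ) (hδ' : δ < Real.pi / 2) (hβ : 0 < β) (hδβ : Real.sin δ < β * Real.cos δ)
    (hx0 : x 0 ∈ Icc (Real.pi / 2) (Real.pi - δ)) (hb0 : β ≤ b 0) :
    x t ∈ Icc (Real.pi / 2) (Real.pi - δ) ∧ β ≤ b t := by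
  let R : Set (ℝ × ℝ) := Icc (Real.pi / 2) (Real.pi - δ) ×ˢ Ici β
  have hcos : 0 < Real.cos δ := Real.cos_pos_of_mem_Ioo ⟨by linarith, hδ'⟩
  have hclosed : IsClosed ((fun s => (x s, b s)) ⁻¹' R ∩ Icc 0 t) := by
    rw [inter_comm]
    refine ContinuousOn.preimage_isClosed_of_isClosed ?_ isClosed_Icc
      (isClosed_Icc.prod isClosed_Ici)
    exact fun s hs =>
      ((hx s hs).continuousAt.prodMk (hb s hs).continuousAt).continuousWithinAt
  have hsub : Icc 0 t ⊆ (fun s => (x s, b s)) ⁻¹' R := by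
    refine hclosed.Icc_subset_of_forall_exists_gt ⟨hx0, hb0⟩ ?_
    rintro s ⟨⟨⟨hl, hu⟩, hbs⟩, hs⟩ y hy
    simp only [mem_Ici] at hl hu hbs
    have hxs := hx s (Ico_subset_Icc_self hs)
    have hbd := hb s (Ico_subset_Icc_self hs)
    have h1 := eventually_nonneg_right_of_hasDerivAt (hxs.sub_const (Real.pi / 2))
      (sub_nonneg.2 hl) fun h => by
        rw [sub_eq_zero.1 h]; simp
    have h2 := eventually_nonneg_right_of_hasDerivAt (hxs.const_sub (Real.pi - δ))
      (sub_nonneg.2 hu) fun h => by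
        rw [← sub_eq_zero.1 h, Real.cos_pi_sub, Real.sin_pi_sub]
        nlinarith
    have h3 := eventually_nonneg_right_of_hasDerivAt (hbd.sub_const β)
      (sub_nonneg.2 hbs) fun _ => by
        have hbpos : 0 < b s := hβ.trans_le hbs
        have hsin : 0 < Real.sin (x s) :=
          Real.sin_pos_of_pos_of_lt_pi (by linarith) (by linarith)
        have hcosx : Real.cos (x s) ≤ 0 :=
          Real.cos_nonpos_of_pi_div_two_le_of_le hl (by linarith)
        have := mul_nonneg (neg_nonneg.2 hcosx) hbpos.le
        have : 0 < 1 / 2 * Real.sin (x s) * b s ^ 2 := by positivity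
        linarith
    obtain ⟨r, hr1, hr2, hr3, hr⟩ :=
      (h1.and (h2.and (h3.and (Ioc_mem_nhdsGT hy)))).exists
    exact ⟨r, ⟨⟨sub_nonneg.1 hr1, sub_nonneg.1 hr2⟩, sub_nonneg.1 hr3⟩, hr⟩
  exact hsub ⟨ht, le_rfl⟩


/-- **The projected geodesic stays uniformly away from `x = π`.**
Consider the system `(S)`: `x' = b·cos x + sin x`, `b' = (1/2)·sin(x)·b² − cos(x)·b`.
For `0 < T ≤ ∞` and a solution `(x, b)` on `[0, T)` with `x 0 = π/2` and
`b 0 > 0`, there exists `δ > 0` such that `x s ≤ π − δ` for every `s ∈ [0, T)`;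
in particular `sin (x s) ≥ sin δ > 0` for all `s ∈ [0, T)`. -/
theorem stays_away_from_pi (T : EReal) (hT : 0 < T)
    (x b : ℝ → ℝ)
    (hx : ∀ s : ℝ, 0 ≤ s → (s : EReal) < T →
      HasDerivAt x (b s * Real.cos (x s) + Real.sin (x s)) s)
    (hb : ∀ s : ℝ, 0 ≤ s → (s : EReal) < T →
      HasDerivAt b (1 / 2 * Real.sin (x s) * (b s) ^ 2 - Real.cos (x s) * b s) s)
    (hx0 : x 0 = Real.pi / 2) (hb0 : 0 < b 0) :
    ∃ δ : ℝ, 0 < δ ∧ 0 < Real.sin δ ∧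
      ∀ s : ℝ, 0 ≤ s → (s : EReal) < T →
        x s ≤ Real.pi - δ ∧ Real.sin δ ≤ Real.sin (x s) := by
  have hδ : 0 < Real.arctan (b 0 / 2) := Real.arctan_pos.2 (half_pos hb0)
  have hδ' : Real.arctan (b 0 / 2) < Real.pi / 2 := Real.arctan_lt_pi_div_two _
  have hcos : 0 < Real.cos (Real.arctan (b 0 / 2)) := Real.cos_arctan_pos _
  have htan : Real.sin (Real.arctan (b 0 / 2)) = b 0 / 2 * Real.cos (Real.arctan (b 0 / 2)) := by
    rw [← Real.tan_mul_cos hcos.ne', Real.tan_arctan]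
  refine ⟨Real.arctan (b 0 / 2), hδ, by rw [htan]; positivity, fun s hs hsT => ?_⟩
  have hlt : ∀ r ∈ Set.Icc 0 s, (r : EReal) < T := fun r hr =>
    (EReal.coe_le_coe_iff.2 hr.2).trans_lt hsT
  obtain ⟨⟨hl, hu⟩, -⟩ := geodesic_region_invariant hs (fun r hr => hx r hr.1 (hlt r hr))
    (fun r hr => hb r hr.1 (hlt r hr)) hδ hδ' hb0 (by rw [htan]; nlinarith)
    ⟨hx0.ge, by linarith⟩ le_rfl
  refine ⟨hu, ?_⟩
  rw [← Real.sin_pi_sub (x s)]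
  exact Real.sin_le_sin_of_le_of_le_pi_div_two (by linarith) (by linarith) (by linarith)
end
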